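/- Let p be a prime, m ∈ ℕ, let h_n, h_k ∈ ℚ(p^m) with h_n ≠ h_k, let σ_m ∈ ℚ(p^m), and γ > 0. Then p^m ∫_0^{p^{−m}} [ 1 + γ min{ 1 − h_n ⊕_p (σ_m + δ), 1 − h_k ⊕_p (σ_m + δ) } ] dδ = − (γ/2) p^{−m} + 1 + γ min{ 1 − (h_n ⊕_{p,m}^{simp} σ_m), 1 − (h_k ⊕_{p,m}^{simp} σ_m) }. -/

import Mathlib

open MeasureTheory Finset

/-- The digit of `x ∈ [0,1)` at base-`p` position `r` (the coefficient of `p^{-(r+1)}`),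
using the finite expansion for `p`-adic rationals. -/
noncomputable def rdigit (p : ℕ) (x : ℝ) (r : ℕ) : ℕ :=
  (⌊x * (p : ℝ) ^ (r + 1)⌋).toNat % p

/-- The value of the `p`-adic integer `φ_p^+(x)` modulo `p^m`, as a natural number. -/
noncomputable def truncVal (p : ℕ) (x : ℝ) (m : ℕ) : ℕ :=
  ∑ r ∈ Finset.range m, rdigit p x r * p ^ r

/-- Digit `r` of the `p`-adic sum `φ_p^+(x) +_{ℤ_p} φ_p^+(σ)`. -/
noncomputable def sdigit (p : ℕ) (x σ : ℝ) (r : ℕ) : ℕ :=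
  (truncVal p x (r + 1) + truncVal p σ (r + 1)) % p ^ (r + 1) / p ^ r

/-- The `p`-adic shift `x ⊕_p σ = φ_p(φ_p^+(x) +_{ℤ_p} φ_p^+(σ))` (the Monna map applied to
the `p`-adic sum, taken mod 1). -/
noncomputable def pshift (p : ℕ) (x σ : ℝ) : ℝ :=
  Int.fract (∑' r : ℕ, (sdigit p x σ r : ℝ) / (p : ℝ) ^ (r + 1))

/-- The simplified `p`-adic shift `x ⊕_{p,m}^{simp} σ`: the truncation of `x ⊕_p σ` to its `m`
most significant base-`p` digits. -/
noncomputable def simpShift (p m : ℕ) (x σ : ℝ) : ℝ :=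
  ∑ r ∈ Finset.range m, (sdigit p x σ r : ℝ) / (p : ℝ) ^ (r + 1)

/-- The mid-simplified `p`-adic shift `x ⊕_{p,m}^{simi} σ = (x ⊕_{p,m}^{simp} σ) + 1/(2p^m)`. -/
noncomputable def midShift (p m : ℕ) (x σ : ℝ) : ℝ :=
  simpShift p m x σ + 1 / (2 * (p : ℝ) ^ m)

/-- The radical inverse function `φ_p(n) = Σ_r n_r p^{-(r+1)}` in base `p`. -/
noncomputable def radInv (p n : ℕ) : ℝ :=
  ∑' r : ℕ, ((n / p ^ r % p : ℕ) : ℝ) / (p : ℝ) ^ (r + 1)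

/-- Membership in `ℚ(p^m) = {a p^{-m} : a = 0,1,…,p^m - 1}`. -/
def QSet (p m : ℕ) (x : ℝ) : Prop :=
  ∃ a : ℕ, a < p ^ m ∧ x = (a : ℝ) / (p : ℝ) ^ m

/-- The squared worst-case error of the QMC rule based on the `N`-element point set
`P ⊆ [0,1)^d` in the weighted anchored Sobolev space with weights `γ` (0-indexed, so the
paper's `γ_j` is `γ (j-1)`). -/
noncomputable def sqErr (d N : ℕ) (γ : ℕ → ℝ) (P : Fin N → Fin d → ℝ) : ℝ :=
  (∏ j : Fin d, (1 + γ j.val / 3))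
    - 2 / (N : ℝ) * ∑ n : Fin N, ∏ j : Fin d, (1 + γ j.val / 2 * (1 - P n j ^ 2))
    + 1 / (N : ℝ) ^ 2 *
        ∑ n : Fin N, ∑ h : Fin N, ∏ j : Fin d, (1 + γ j.val * min (1 - P n j) (1 - P h j))

theorem rdigit_eq_floor (p : ℕ) (x : ℝ) (r : ℕ) :
    rdigit p x r = ⌊x * (p : ℝ) ^ (r + 1)⌋₊ % p := by
  rw [rdigit, Int.floor_toNat]

theorem rdigit_lt {p : ℕ} (hp : 0 < p) (x : ℝ) (r : ℕ) : rdigit p x r < p :=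
  Nat.mod_lt _ hp

theorem sdigit_comm (p : ℕ) (x σ : ℝ) (r : ℕ) : sdigit p x σ r = sdigit p σ x r := by
  rw [sdigit, sdigit, add_comm]

theorem sdigit_eq {p : ℕ} (hp : 0 < p) (x σ : ℝ) (r : ℕ) :
    sdigit p x σ r =
      ((truncVal p x (r + 1) + truncVal p σ r) / p ^ r + rdigit p σ r) % p := by
  have h : truncVal p σ (r + 1) = truncVal p σ r + rdigit p σ r * p ^ r := by
    simp [truncVal, Finset.sum_range_succ]
  rw [sdigit, h, pow_succ p r, Nat.mod_mul_right_div_self, ← add_assoc,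
    Nat.add_mul_div_right _ _ (pow_pos hp r)]

theorem sdigit_lt {p : ℕ} (hp : 0 < p) (x σ : ℝ) (r : ℕ) : sdigit p x σ r < p := by
  rw [sdigit_eq hp]
  exact Nat.mod_lt _ hp

/-- Coarser floors are obtained from finer ones by integer division. -/
theorem floor_mul_pow_eq_div {p : ℕ} (hp : 0 < p) (x : ℝ) {r N : ℕ} (h : r ≤ N) :
    ⌊x * (p : ℝ) ^ r⌋₊ = ⌊x * (p : ℝ) ^ N⌋₊ / p ^ (N - r) := by
  have hp' : (p : ℝ) ≠ 0 := by positivity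
  rw [← Nat.floor_div_natCast]
  congr 1
  rw [Nat.cast_pow, eq_div_iff (by positivity), mul_assoc, ← pow_add, Nat.add_sub_cancel' h]

theorem rdigit_congr {p : ℕ} (hp : 0 < p) {x y : ℝ} {r N : ℕ} (h : r < N)
    (hxy : ⌊x * (p : ℝ) ^ N⌋₊ = ⌊y * (p : ℝ) ^ N⌋₊) : rdigit p x r = rdigit p y r := by
  rw [rdigit_eq_floor, rdigit_eq_floor, floor_mul_pow_eq_div hp x (Nat.succ_le_of_lt h), hxy,
    ← floor_mul_pow_eq_div hp y (Nat.succ_le_of_lt h)]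

theorem truncVal_congr {p : ℕ} (hp : 0 < p) {x y : ℝ} {r N : ℕ} (h : r ≤ N)
    (hxy : ⌊x * (p : ℝ) ^ N⌋₊ = ⌊y * (p : ℝ) ^ N⌋₊) : truncVal p x r = truncVal p y r :=
  Finset.sum_congr rfl fun i hi => by
    rw [rdigit_congr hp ((Finset.mem_range.1 hi).trans_le h) hxy]

theorem sdigit_congr {p : ℕ} (hp : 0 < p) (x : ℝ) {σ τ : ℝ} {r N : ℕ} (h : r < N)
    (hστ : ⌊σ * (p : ℝ) ^ N⌋₊ = ⌊τ * (p : ℝ) ^ N⌋₊) : sdigit p x σ r = sdigit p x τ r := by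
  rw [sdigit, sdigit, truncVal_congr hp (Nat.succ_le_of_lt h) hστ]

/-- The digits of a `p`-adic sum determine the digits of the second summand. -/
theorem rdigit_eq_of_sdigit_eq {p : ℕ} (hp : 0 < p) (x : ℝ) {σ τ : ℝ} {N : ℕ}
    (h : ∀ r < N, sdigit p x σ r = sdigit p x τ r) : ∀ r < N, rdigit p σ r = rdigit p τ r := by
  intro r
  induction r using Nat.strong_induction_on with
  | _ r ih =>
    intro hr
    have ht : truncVal p σ r = truncVal p τ r :=
      Finset.sum_congr rfl fun i hi => by
        rw [ih i (Finset.mem_range.1 hi) ((Finset.mem_range.1 hi).trans hr)]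
    have h1 := h r hr
    rw [sdigit_eq hp, sdigit_eq hp, ht] at h1
    have h2 : rdigit p σ r ≡ rdigit p τ r [MOD p] := Nat.ModEq.add_left_cancel' _ h1
    exact h2.eq_of_lt_of_lt (rdigit_lt hp _ _) (rdigit_lt hp _ _)

theorem floor_eq_of_rdigit_eq {p : ℕ} (hp : 0 < p) {x y : ℝ} (hx : x < 1) (hy : y < 1) {N : ℕ}
    (h : ∀ r < N, rdigit p x r = rdigit p y r) :
    ⌊x * (p : ℝ) ^ N⌋₊ = ⌊y * (p : ℝ) ^ N⌋₊ := by
  induction N with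
  | zero => simp [Nat.floor_eq_zero.2 hx, Nat.floor_eq_zero.2 hy]
  | succ N ih =>
    have h1 := ih fun r hr => h r (hr.trans N.lt_succ_self)
    have h2 := h N N.lt_succ_self
    rw [rdigit_eq_floor, rdigit_eq_floor] at h2
    rw [floor_mul_pow_eq_div hp x N.le_succ, floor_mul_pow_eq_div hp y N.le_succ] at h1
    simp only [Nat.succ_eq_add_one, Nat.add_sub_cancel_left, pow_one] at h1
    rw [← Nat.div_add_mod ⌊x * (p : ℝ) ^ (N + 1)⌋₊ p, h1, h2, Nat.div_add_mod]

theorem eq_of_sdigit_eq {p : ℕ} (hp : 1 < p) (x : ℝ) {σ τ : ℝ} (hσ : σ ∈ Set.Ico (0 : ℝ) 1)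
    (hτ : τ ∈ Set.Ico (0 : ℝ) 1) (h : ∀ r, sdigit p x σ r = sdigit p x τ r) : σ = τ := by
  have hp0 : 0 < p := by omega
  have key : ∀ N : ℕ, |σ - τ| * (p : ℝ) ^ N < 1 := by
    intro N
    have hf := floor_eq_of_rdigit_eq hp0 hσ.2 hτ.2
      (rdigit_eq_of_sdigit_eq hp0 x (N := N) fun r _ => h r)
    have hpN : (0 : ℝ) < (p : ℝ) ^ N := by positivity
    have h1 := Nat.floor_le (mul_nonneg hσ.1 hpN.le)
    have h2 := Nat.lt_floor_add_one (σ * (p : ℝ) ^ N)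
    have h3 := Nat.floor_le (mul_nonneg hτ.1 hpN.le)
    have h4 := Nat.lt_floor_add_one (τ * (p : ℝ) ^ N)
    rw [hf] at h1 h2
    rw [← abs_of_pos hpN, ← abs_mul, sub_mul, abs_lt]
    constructor <;> linarith
  by_contra hne
  have hpos : 0 < |σ - τ| := abs_pos.2 (sub_ne_zero.2 hne)
  obtain ⟨N, hN⟩ := pow_unbounded_of_one_lt (1 / |σ - τ|) (Nat.one_lt_cast.2 hp : (1 : ℝ) < p)
  rw [div_lt_iff₀ hpos, mul_comm] at hN
  exact lt_asymm hN (key N)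

theorem sum_range_add_mod (p c : ℕ) :
    ∑ d ∈ Finset.range p, (c + d) % p = ∑ d ∈ Finset.range p, d := by
  induction c with
  | zero =>
    exact Finset.sum_congr rfl fun d hd => by
      rw [zero_add, Nat.mod_eq_of_lt (Finset.mem_range.1 hd)]
  | succ c ih =>
    rw [← ih]
    have h1 := Finset.sum_range_succ (fun d => (c + d) % p) p
    have h2 := Finset.sum_range_succ' (fun d => (c + d) % p) p
    simp only [Nat.add_mod_right, add_zero] at h1 h2
    rw [h1] at h2
    have h3 := Nat.add_right_cancel h2
    rw [h3]
    exact Finset.sum_congr rfl fun d _ => by congr 1; ring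

theorem measurable_sdigit (p : ℕ) (x : ℝ) (r : ℕ) :
    Measurable fun σ => (sdigit p x σ r : ℝ) := by
  have h1 : ∀ i, Measurable fun σ => rdigit p σ i := fun i =>
    (measurable_from_top (f := fun z : ℤ => z.toNat % p)).comp
      (Int.measurable_floor.comp (measurable_id.mul_const _))
  have h2 : Measurable fun σ => truncVal p σ (r + 1) :=
    Finset.measurable_fun_sum _ fun i _ => (h1 i).mul_const _
  exact (measurable_from_top
    (f := fun n : ℕ => (((truncVal p x (r + 1) + n) % p ^ (r + 1) / p ^ r : ℕ) : ℝ))).comp h2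

theorem intervalIntegrable_sdigit {p : ℕ} (hp : 0 < p) (x : ℝ) (r : ℕ) (a b : ℝ) :
    IntervalIntegrable (fun σ => (sdigit p x σ r : ℝ)) volume a b := by
  refine (intervalIntegrable_const (c := (p : ℝ))).mono_fun
    (measurable_sdigit p x r).aestronglyMeasurable (Filter.Eventually.of_forall fun σ => ?_)
  simpa using (sdigit_lt hp x σ r).le

/-- On a cell of generation `r + 1` the digit `r` of the `p`-adic sum is constant. -/
theorem integral_sdigit_cell {p : ℕ} (hp : 0 < p) (x : ℝ) (r n d : ℕ) (hd : d < p) :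
    ∫ σ in (((n * p + d : ℕ) : ℝ) / (p : ℝ) ^ (r + 1))..(((n * p + d + 1 : ℕ) : ℝ) /
      (p : ℝ) ^ (r + 1)), (sdigit p x σ r : ℝ) =
    (((truncVal p x (r + 1) + truncVal p ((n : ℝ) / (p : ℝ) ^ r) r) / p ^ r + d) % p : ℕ)
      / (p : ℝ) ^ (r + 1) := by
  have hq : (0 : ℝ) < (p : ℝ) ^ (r + 1) := by positivity
  have hp' : (0 : ℝ) < p := by positivity
  rw [intervalIntegral.integral_congr_Ioo_of_le (g := fun _ =>
    ((((truncVal p x (r + 1) + truncVal p ((n : ℝ) / (p : ℝ) ^ r) r) / p ^ r + d) % p : ℕ) : ℝ))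
    (by gcongr ?_ / _; exact_mod_cast Nat.le_succ _)]
  · rw [intervalIntegral.integral_const, smul_eq_mul]
    push_cast
    field_simp
    ring
  · intro σ hσ
    have h1 := (div_lt_iff₀ hq).1 hσ.1
    have h2 := (lt_div_iff₀ hq).1 hσ.2
    have hf : ⌊σ * (p : ℝ) ^ (r + 1)⌋₊ = n * p + d := by
      rw [Nat.floor_eq_iff ((Nat.cast_nonneg _).trans h1.le)]
      exact ⟨h1.le, by exact_mod_cast h2⟩
    have hg : ⌊σ * (p : ℝ) ^ r⌋₊ = ⌊(n : ℝ) / (p : ℝ) ^ r * (p : ℝ) ^ r⌋₊ := by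
      rw [floor_mul_pow_eq_div hp σ r.le_succ, hf, div_mul_cancel₀ _ (by positivity),
        Nat.floor_natCast, Nat.succ_eq_add_one, Nat.add_sub_cancel_left, pow_one, mul_comm,
        Nat.mul_add_div hp, Nat.div_eq_of_lt hd, add_zero]
    have hd' : rdigit p σ r = d := by
      rw [rdigit_eq_floor, hf, Nat.mul_add_mod_self_right, Nat.mod_eq_of_lt hd]
    simp only [sdigit_eq hp x σ r, truncVal_congr hp le_rfl hg, hd']

theorem integral_sdigit_parent {p : ℕ} (hp : 0 < p) (x : ℝ) (r n : ℕ) :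
    ∫ σ in ((n : ℝ) / (p : ℝ) ^ r)..(((n + 1 : ℕ) : ℝ) / (p : ℝ) ^ r), (sdigit p x σ r : ℝ) =
      ((p : ℝ) - 1) / 2 / (p : ℝ) ^ r := by
  have hp' : (0 : ℝ) < p := by positivity
  have h := intervalIntegral.sum_integral_adjacent_intervals (μ := volume)
    (f := fun σ => (sdigit p x σ r : ℝ))
    (a := fun d : ℕ => ((n * p + d : ℕ) : ℝ) / (p : ℝ) ^ (r + 1)) (n := p)
    fun k _ => intervalIntegrable_sdigit hp x r _ _
  simp only [← add_assoc] at h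
  rw [Finset.sum_congr rfl fun d hd =>
    integral_sdigit_cell hp x r n d (Finset.mem_range.1 hd), ← Finset.sum_div, ← Nat.cast_sum,
    sum_range_add_mod p] at h
  have e1 : ((n * p + 0 : ℕ) : ℝ) / (p : ℝ) ^ (r + 1) = (n : ℝ) / (p : ℝ) ^ r := by
    push_cast
    field_simp
    ring
  have e2 : ((n * p + p : ℕ) : ℝ) / (p : ℝ) ^ (r + 1) = ((n + 1 : ℕ) : ℝ) / (p : ℝ) ^ r := by
    push_cast
    rw [pow_succ]
    field_simp
  simp only [e1, e2] at h
  have hs : ((∑ d ∈ Finset.range p, d : ℕ) : ℝ) = p * (p - 1) / 2 := by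
    have := congrArg (Nat.cast (R := ℝ)) (Finset.sum_range_id_mul_two p)
    rw [Nat.cast_mul, Nat.cast_mul, Nat.cast_sub hp] at this
    push_cast at this ⊢
    linarith
  rw [← h, hs, pow_succ]
  field_simp

theorem integral_sdigit {p : ℕ} (hp : 0 < p) (x : ℝ) (m k A : ℕ) :
    ∫ σ in ((A : ℝ) / (p : ℝ) ^ m)..(((A + 1 : ℕ) : ℝ) / (p : ℝ) ^ m),
      (sdigit p x σ (k + m) : ℝ) = ((p : ℝ) - 1) / 2 / (p : ℝ) ^ m := by
  have hp' : (0 : ℝ) < p := by positivity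
  have h := intervalIntegral.sum_integral_adjacent_intervals (μ := volume)
    (f := fun σ => (sdigit p x σ (k + m) : ℝ))
    (a := fun d : ℕ => ((A * p ^ k + d : ℕ) : ℝ) / (p : ℝ) ^ (k + m)) (n := p ^ k)
    fun _ _ => intervalIntegrable_sdigit hp x _ _ _
  simp only [← add_assoc] at h
  simp only [integral_sdigit_parent hp, Finset.sum_const, Finset.card_range, nsmul_eq_mul] at h
  have e1 : ((A * p ^ k + 0 : ℕ) : ℝ) / (p : ℝ) ^ (k + m) = (A : ℝ) / (p : ℝ) ^ m := by
    push_cast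
    field_simp
    ring
  have e2 : ((A * p ^ k + p ^ k : ℕ) : ℝ) / (p : ℝ) ^ (k + m) =
      ((A + 1 : ℕ) : ℝ) / (p : ℝ) ^ m := by
    push_cast
    rw [pow_add]
    field_simp
  rw [e1, e2] at h
  rw [← h, pow_add]
  push_cast
  field_simp

theorem hasSum_top_digits {p : ℕ} (hp : 1 < p) :
    HasSum (fun r : ℕ => ((p : ℝ) - 1) / (p : ℝ) ^ (r + 1)) 1 := by
  have hp' : (1 : ℝ) < p := Nat.one_lt_cast.2 hp
  have h := (hasSum_geometric_of_lt_one (r := (p : ℝ)⁻¹) (by positivity)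
    (inv_lt_one_of_one_lt₀ hp')).mul_left (((p : ℝ) - 1) / p)
  have h0 : (p : ℝ) - 1 ≠ 0 := by linarith
  have e1 : ((p : ℝ) - 1) / p * (1 - (p : ℝ)⁻¹)⁻¹ = 1 := by
    have e0 : 1 - (p : ℝ)⁻¹ = ((p : ℝ) - 1) / p := by field_simp
    rw [e0]
    field_simp
  rw [e1] at h
  refine h.congr_fun fun r => ?_
  rw [pow_succ, inv_pow]
  field_simp

theorem digit_div_le {p : ℕ} {d : ℕ → ℕ} (hd : ∀ r, d r < p) (r : ℕ) :
    (d r : ℝ) / (p : ℝ) ^ (r + 1) ≤ ((p : ℝ) - 1) / (p : ℝ) ^ (r + 1) := by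
  have h : (d r : ℝ) + 1 ≤ p := by exact_mod_cast hd r
  gcongr
  linarith

theorem summable_digits {p : ℕ} (hp : 1 < p) {d : ℕ → ℕ} (hd : ∀ r, d r < p) :
    Summable fun r : ℕ => (d r : ℝ) / (p : ℝ) ^ (r + 1) :=
  (hasSum_top_digits hp).summable.of_nonneg_of_le (fun _ => by positivity) (digit_div_le hd)

theorem tsum_digits_le_one {p : ℕ} (hp : 1 < p) {d : ℕ → ℕ} (hd : ∀ r, d r < p) :
    ∑' r : ℕ, (d r : ℝ) / (p : ℝ) ^ (r + 1) ≤ 1 := by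
  rw [← (hasSum_top_digits hp).tsum_eq]
  exact (summable_digits hp hd).tsum_le_tsum (digit_div_le hd) (hasSum_top_digits hp).summable

theorem digit_eq_of_one_le_tsum {p : ℕ} (hp : 1 < p) {d : ℕ → ℕ} (hd : ∀ r, d r < p)
    (h : 1 ≤ ∑' r : ℕ, (d r : ℝ) / (p : ℝ) ^ (r + 1)) (r : ℕ) : d r = p - 1 := by
  by_contra hne
  have h1 : ((d r : ℝ)) + 1 < p := by
    have := hd r
    exact_mod_cast (show d r + 1 < p by omega)
  have hp' : 0 < p := by omega
  refine h.not_gt ?_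
  rw [← (hasSum_top_digits hp).tsum_eq]
  refine Summable.tsum_lt_tsum (i := r) (digit_div_le hd) ?_ (summable_digits hp hd)
    (hasSum_top_digits hp).summable
  gcongr
  linarith

theorem tsum_digits_mem_Icc {p : ℕ} (hp : 1 < p) {d : ℕ → ℕ} (hd : ∀ r, d r < p) (m : ℕ) :
    ∑' r : ℕ, (d r : ℝ) / (p : ℝ) ^ (r + 1) ∈
      Set.Icc (∑ r ∈ Finset.range m, (d r : ℝ) / (p : ℝ) ^ (r + 1))
        (∑ r ∈ Finset.range m, (d r : ℝ) / (p : ℝ) ^ (r + 1) + ((p : ℝ) ^ m)⁻¹) := by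
  have hp' : 0 < p := by omega
  rw [← (summable_digits hp hd).sum_add_tsum_nat_add m]
  have e : ∀ k : ℕ, (d (k + m) : ℝ) / (p : ℝ) ^ (k + m + 1) =
      (d (k + m) : ℝ) / (p : ℝ) ^ (k + 1) * ((p : ℝ) ^ m)⁻¹ := fun k => by
    rw [add_right_comm, pow_add]
    field_simp
  have h0 : (0 : ℝ) ≤ ∑' k : ℕ, (d (k + m) : ℝ) / (p : ℝ) ^ (k + 1) :=
    tsum_nonneg fun _ => by positivity
  have h1 := tsum_digits_le_one hp (d := fun k => d (k + m)) fun k => hd _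
  simp only [e, tsum_mul_right]
  refine ⟨le_add_of_nonneg_right (by positivity), ?_⟩
  gcongr
  exact mul_le_of_le_one_left (by positivity) h1

/-- The integer with base-`p` digits `d 0, …, d (m - 1)`, most significant digit first. -/
def leadVal (p : ℕ) (d : ℕ → ℕ) : ℕ → ℕ
  | 0 => 0
  | m + 1 => p * leadVal p d m + d m

theorem sum_range_digits_eq {p : ℕ} (hp : 0 < p) (d : ℕ → ℕ) (m : ℕ) :
    ∑ r ∈ Finset.range m, (d r : ℝ) / (p : ℝ) ^ (r + 1) = (leadVal p d m : ℝ) / (p : ℝ) ^ m := by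
  have hp' : (0 : ℝ) < p := by positivity
  induction m with
  | zero => simp [leadVal]
  | succ m ih =>
    rw [Finset.sum_range_succ, ih, leadVal]
    push_cast
    rw [pow_succ]
    field_simp

theorem digit_eq_of_leadVal_eq {p : ℕ} {d e : ℕ → ℕ} (hd : ∀ r, d r < p) (he : ∀ r, e r < p)
    {m : ℕ} (h : leadVal p d m = leadVal p e m) : ∀ r < m, d r = e r := by
  induction m with
  | zero => simp
  | succ m ih =>
    have hp : 0 < p := (Nat.zero_le _).trans_lt (hd 0)
    rw [leadVal, leadVal] at h
    have h1 := congrArg (· / p) h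
    have h2 := congrArg (· % p) h
    simp only [Nat.mul_add_div hp, Nat.mul_add_mod, Nat.div_eq_of_lt (hd _),
      Nat.div_eq_of_lt (he _), Nat.mod_eq_of_lt (hd _), Nat.mod_eq_of_lt (he _),
      add_zero] at h1 h2
    intro r hr
    rcases Nat.lt_succ_iff_lt_or_eq.1 hr with hr | rfl
    · exact ih h1 r hr
    · exact h2

theorem floor_mul_pow_of_mem_Ico {p : ℕ} (hp : 0 < p) {m A : ℕ} {σ : ℝ}
    (hσ : σ ∈ Set.Ico ((A : ℝ) / (p : ℝ) ^ m) (((A + 1 : ℕ) : ℝ) / (p : ℝ) ^ m)) :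
    ⌊σ * (p : ℝ) ^ m⌋₊ = A := by
  have hq : (0 : ℝ) < (p : ℝ) ^ m := by positivity
  have h1 := (div_le_iff₀ hq).1 hσ.1
  have h2 := (lt_div_iff₀ hq).1 hσ.2
  rw [Nat.floor_eq_iff ((Nat.cast_nonneg _).trans h1)]
  exact ⟨h1, by exact_mod_cast h2⟩

theorem sdigit_eq_of_mem_Ico {p : ℕ} (hp : 0 < p) (x : ℝ) {m A r : ℕ} (hr : r < m) {σ : ℝ}
    (hσ : σ ∈ Set.Ico ((A : ℝ) / (p : ℝ) ^ m) (((A + 1 : ℕ) : ℝ) / (p : ℝ) ^ m)) :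
    sdigit p x σ r = sdigit p x ((A : ℝ) / (p : ℝ) ^ m) r := by
  refine sdigit_congr hp x hr ?_
  rw [floor_mul_pow_of_mem_Ico hp hσ, div_mul_cancel₀ _ (by positivity), Nat.floor_natCast]

theorem simpShift_eq_of_mem_Ico {p : ℕ} (hp : 0 < p) (x : ℝ) {m A : ℕ} {σ : ℝ}
    (hσ : σ ∈ Set.Ico ((A : ℝ) / (p : ℝ) ^ m) (((A + 1 : ℕ) : ℝ) / (p : ℝ) ^ m)) :
    simpShift p m x σ = simpShift p m x ((A : ℝ) / (p : ℝ) ^ m) :=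
  Finset.sum_congr rfl fun r hr => by
    rw [sdigit_eq_of_mem_Ico hp x (Finset.mem_range.1 hr) hσ]

/-- For all but at most one `σ ∈ [0,1)`, reduction modulo `1` is immaterial in the
`p`-adic shift. -/
theorem ae_pshift_eq_tsum {p : ℕ} (hp : 1 < p) (x : ℝ) :
    ∀ᵐ σ : ℝ, σ ∈ Set.Ico (0 : ℝ) 1 →
      pshift p x σ = ∑' r : ℕ, (sdigit p x σ r : ℝ) / (p : ℝ) ^ (r + 1) := by
  have hp0 : 0 < p := by omega
  have hs : {σ : ℝ | σ ∈ Set.Ico (0 : ℝ) 1 ∧ ∀ r, sdigit p x σ r = p - 1}.Subsingleton :=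
    fun σ hσ τ hτ => eq_of_sdigit_eq hp x hσ.1 hτ.1 fun r => (hσ.2 r).trans (hτ.2 r).symm
  filter_upwards [hs.countable.ae_notMem volume] with σ hσ hmem
  rw [pshift, Int.fract_eq_self]
  refine ⟨tsum_nonneg fun _ => by positivity, ?_⟩
  by_contra! h
  exact hσ ⟨hmem, digit_eq_of_one_le_tsum hp (sdigit_lt hp0 x σ) h⟩

theorem hasSum_integral_sdigit {p : ℕ} (hp : 1 < p) (x a b : ℝ) :
    HasSum (fun r : ℕ => ∫ σ in a..b, (sdigit p x σ r : ℝ) / (p : ℝ) ^ (r + 1))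
      (∫ σ in a..b, ∑' r : ℕ, (sdigit p x σ r : ℝ) / (p : ℝ) ^ (r + 1)) := by
  have hp0 : 0 < p := by omega
  refine intervalIntegral.hasSum_integral_of_dominated_convergence
    (fun r _ => ((p : ℝ) - 1) / (p : ℝ) ^ (r + 1))
    (fun r => ((measurable_sdigit p x r).div_const _).aestronglyMeasurable)
    (fun r => Filter.Eventually.of_forall fun σ _ => ?_)
    (Filter.Eventually.of_forall fun _ _ => (hasSum_top_digits hp).summable)
    intervalIntegrable_const
    (Filter.Eventually.of_forall fun σ _ => (summable_digits hp (sdigit_lt hp0 x σ)).hasSum)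
  rw [Real.norm_of_nonneg (by positivity)]
  exact digit_div_le (sdigit_lt hp0 x σ) r

theorem integral_tsum_sdigit {p : ℕ} (hp : 1 < p) (x : ℝ) (m A : ℕ) :
    ∫ σ in ((A : ℝ) / (p : ℝ) ^ m)..(((A + 1 : ℕ) : ℝ) / (p : ℝ) ^ m),
      ∑' r : ℕ, (sdigit p x σ r : ℝ) / (p : ℝ) ^ (r + 1) =
    (simpShift p m x ((A : ℝ) / (p : ℝ) ^ m) + ((p : ℝ) ^ m)⁻¹ / 2) * ((p : ℝ) ^ m)⁻¹ := by
  have hp0 : 0 < p := by omega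
  have hp' : (0 : ℝ) < p := by positivity
  have hlow : ∀ r ∈ Finset.range m,
      ∫ σ in ((A : ℝ) / (p : ℝ) ^ m)..(((A + 1 : ℕ) : ℝ) / (p : ℝ) ^ m),
        (sdigit p x σ r : ℝ) / (p : ℝ) ^ (r + 1) =
      (sdigit p x ((A : ℝ) / (p : ℝ) ^ m) r : ℝ) / (p : ℝ) ^ (r + 1) * ((p : ℝ) ^ m)⁻¹ := by
    intro r hr
    rw [intervalIntegral.integral_congr_Ioo_of_le
      (g := fun _ => (sdigit p x ((A : ℝ) / (p : ℝ) ^ m) r : ℝ) / (p : ℝ) ^ (r + 1))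
      (by gcongr ?_ / _; exact_mod_cast Nat.le_succ _) fun σ hσ => by
        simp only [sdigit_eq_of_mem_Ico hp0 x (Finset.mem_range.1 hr) ⟨hσ.1.le, hσ.2⟩],
      intervalIntegral.integral_const, smul_eq_mul]
    push_cast
    field_simp
    ring
  have hhigh : ∀ k : ℕ,
      ∫ σ in ((A : ℝ) / (p : ℝ) ^ m)..(((A + 1 : ℕ) : ℝ) / (p : ℝ) ^ m),
        (sdigit p x σ (k + m) : ℝ) / (p : ℝ) ^ (k + m + 1) =
      ((p : ℝ) - 1) / (p : ℝ) ^ (k + 1) * (((p : ℝ) ^ m)⁻¹ / 2 * ((p : ℝ) ^ m)⁻¹) := by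
    intro k
    rw [intervalIntegral.integral_div, integral_sdigit hp0, add_right_comm, pow_add]
    field_simp
  have h := hasSum_integral_sdigit hp x ((A : ℝ) / (p : ℝ) ^ m)
    (((A + 1 : ℕ) : ℝ) / (p : ℝ) ^ m)
  rw [← h.tsum_eq, ← h.summable.sum_add_tsum_nat_add m, Finset.sum_congr rfl hlow,
    ← Finset.sum_mul, tsum_congr hhigh, tsum_mul_right, (hasSum_top_digits hp).tsum_eq,
    simpShift]
  ring

theorem simpShift_ne {p : ℕ} (hp : 0 < p) {m : ℕ} {x y : ℝ} (hx : QSet p m x)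
    (hy : QSet p m y) (hne : x ≠ y) (σ : ℝ) : simpShift p m x σ ≠ simpShift p m y σ := by
  have hq : (0 : ℝ) < (p : ℝ) ^ m := by positivity
  intro h
  rw [simpShift, simpShift, sum_range_digits_eq hp, sum_range_digits_eq hp,
    div_left_inj' hq.ne', Nat.cast_inj] at h
  have h1 := digit_eq_of_leadVal_eq (sdigit_lt hp x σ) (sdigit_lt hp y σ) h
  obtain ⟨a, ha, rfl⟩ := hx
  obtain ⟨b, hb, rfl⟩ := hy
  have h2 := floor_eq_of_rdigit_eq hp (x := (a : ℝ) / (p : ℝ) ^ m)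
    (y := (b : ℝ) / (p : ℝ) ^ m) ((div_lt_one hq).2 (by exact_mod_cast ha)) ((div_lt_one hq).2 (by exact_mod_cast hb))
    (rdigit_eq_of_sdigit_eq hp σ fun r hr => by
      rw [sdigit_comm, h1 r hr, sdigit_comm])
  rw [div_mul_cancel₀ _ hq.ne', div_mul_cancel₀ _ hq.ne', Nat.floor_natCast,
    Nat.floor_natCast] at h2
  exact hne (by rw [h2])

theorem simpShift_add_le_of_lt {p : ℕ} (hp : 0 < p) {m : ℕ} {x y σ : ℝ}
    (h : simpShift p m x σ < simpShift p m y σ) :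
    simpShift p m x σ + ((p : ℝ) ^ m)⁻¹ ≤ simpShift p m y σ := by
  have hq : (0 : ℝ) < (p : ℝ) ^ m := by positivity
  rw [simpShift, simpShift, sum_range_digits_eq hp, sum_range_digits_eq hp] at h ⊢
  rw [div_lt_div_iff_of_pos_right hq, Nat.cast_lt] at h
  rw [inv_eq_one_div, ← add_div, div_le_div_iff_of_pos_right hq]
  exact_mod_cast h

theorem cell_average_of_simpShift_lt {p : ℕ} (hp : 1 < p) {m A : ℕ} (hA : A < p ^ m) {x y : ℝ}
    {γ : ℝ} (h : simpShift p m x ((A : ℝ) / (p : ℝ) ^ m) <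
      simpShift p m y ((A : ℝ) / (p : ℝ) ^ m)) :
    (p : ℝ) ^ m * ∫ δ in Set.Ico (0 : ℝ) (((p : ℝ) ^ m)⁻¹),
      (1 + γ * min (1 - pshift p x ((A : ℝ) / (p : ℝ) ^ m + δ))
        (1 - pshift p y ((A : ℝ) / (p : ℝ) ^ m + δ))) =
    -(γ / 2) * ((p : ℝ) ^ m)⁻¹ + 1 +
      γ * min (1 - simpShift p m x ((A : ℝ) / (p : ℝ) ^ m))
        (1 - simpShift p m y ((A : ℝ) / (p : ℝ) ^ m)) := by
  have hp0 : 0 < p := by omega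
  have hq : (0 : ℝ) < (p : ℝ) ^ m := by positivity
  have hend : (A : ℝ) / (p : ℝ) ^ m + ((p : ℝ) ^ m)⁻¹ = ((A + 1 : ℕ) : ℝ) / (p : ℝ) ^ m := by
    push_cast
    rw [add_div, one_div]
  have hle : (A : ℝ) / (p : ℝ) ^ m ≤ ((A + 1 : ℕ) : ℝ) / (p : ℝ) ^ m := by
    rw [← hend]
    exact le_add_of_nonneg_right (by positivity)
  have hcongr : ∫ σ in ((A : ℝ) / (p : ℝ) ^ m)..(((A + 1 : ℕ) : ℝ) / (p : ℝ) ^ m),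
        (1 + γ * min (1 - pshift p x σ) (1 - pshift p y σ)) =
      ∫ σ in ((A : ℝ) / (p : ℝ) ^ m)..(((A + 1 : ℕ) : ℝ) / (p : ℝ) ^ m),
        ((1 + γ) - γ * ∑' r : ℕ, (sdigit p y σ r : ℝ) / (p : ℝ) ^ (r + 1)) := by
    refine intervalIntegral.integral_congr_ae ?_
    filter_upwards [ae_pshift_eq_tsum hp x, ae_pshift_eq_tsum hp y,
      Measure.ae_ne volume (((A + 1 : ℕ) : ℝ) / (p : ℝ) ^ m)] with σ hx hy hne hσ
    rw [Set.uIoc_of_le hle] at hσ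
    have hcell : σ ∈ Set.Ico ((A : ℝ) / (p : ℝ) ^ m) (((A + 1 : ℕ) : ℝ) / (p : ℝ) ^ m) :=
      ⟨hσ.1.le, lt_of_le_of_ne hσ.2 hne⟩
    have hunit : σ ∈ Set.Ico (0 : ℝ) 1 := by
      refine ⟨(by positivity : (0 : ℝ) ≤ (A : ℝ) / (p : ℝ) ^ m).trans hcell.1,
        hcell.2.trans_le ((div_le_one hq).2 ?_)⟩
      exact_mod_cast hA
    have h1 := (tsum_digits_mem_Icc hp (sdigit_lt hp0 x σ) m).2
    have h2 := (tsum_digits_mem_Icc hp (sdigit_lt hp0 y σ) m).1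
    have h3 := simpShift_add_le_of_lt hp0 h
    rw [← simpShift_eq_of_mem_Ico hp0 x hcell, ← simpShift_eq_of_mem_Ico hp0 y hcell,
      simpShift, simpShift] at h3
    rw [hx hunit, hy hunit, min_eq_right (by linarith)]
    ring
  have hint : IntervalIntegrable
      (fun σ => ∑' r : ℕ, (sdigit p y σ r : ℝ) / (p : ℝ) ^ (r + 1)) volume
      ((A : ℝ) / (p : ℝ) ^ m) (((A + 1 : ℕ) : ℝ) / (p : ℝ) ^ m) := by
    refine (intervalIntegrable_const (c := (1 : ℝ))).mono_fun
      (Measurable.aestronglyMeasurable ?_) (Filter.Eventually.of_forall fun σ => ?_)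
    · exact Measurable.tsum fun r => (measurable_sdigit p y r).div_const _
    · beta_reduce
      rw [Real.norm_of_nonneg (tsum_nonneg fun _ => by positivity), norm_one]
      exact tsum_digits_le_one hp (sdigit_lt hp0 y σ)
  rw [integral_Ico_eq_integral_Ioc, ← intervalIntegral.integral_of_le (by positivity),
    intervalIntegral.integral_comp_add_left
      (fun σ => 1 + γ * min (1 - pshift p x σ) (1 - pshift p y σ)), add_zero, hend, hcongr,
    intervalIntegral.integral_sub intervalIntegrable_const (hint.const_mul γ),
    intervalIntegral.integral_const, intervalIntegral.integral_const_mul,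
    integral_tsum_sdigit hp, min_eq_right (by linarith), ← hend, add_sub_cancel_left,
    smul_eq_mul]
  field_simp
  ring

/-- exact evaluation of the cell average of
`1 + γ min{1 - h_n ⊕_p (σ_m + δ), 1 - h_k ⊕_p (σ_m + δ)}` for distinct `h_n, h_k ∈ ℚ(p^m)`. -/
theorem cell_average_min_term
    (p : ℕ) (hp : p.Prime) (m : ℕ) (hm : 0 < m)
    (hn hk : ℝ) (hhn : QSet p m hn) (hhk : QSet p m hk) (hne : hn ≠ hk)
    (σm : ℝ) (hσ : QSet p m σm)
    (γ : ℝ) (hγ : 0 < γ) :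
    (p : ℝ) ^ m *
        ∫ δ in Set.Ico (0 : ℝ) (((p : ℝ) ^ m)⁻¹),
          (1 + γ * min (1 - pshift p hn (σm + δ)) (1 - pshift p hk (σm + δ))) =
      -(γ / 2) * ((p : ℝ) ^ m)⁻¹ + 1 +
        γ * min (1 - simpShift p m hn σm) (1 - simpShift p m hk σm) := by
  obtain ⟨A, hA, rfl⟩ := hσ
  rcases (simpShift_ne hp.pos hhn hhk hne ((A : ℝ) / (p : ℝ) ^ m)).lt_or_gt with h | h
  · exact cell_average_of_simpShift_lt hp.one_lt hA h
  · have := cell_average_of_simpShift_lt hp.one_lt hA (γ := γ) h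
    simpa only [min_comm] using this
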